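/- arXiv:2401.04073 — 2 statements merged into one kernel-verified Lean document; each statement's English description precedes it below -/
import Mathlib

section
/- Fix a positive integer k and a real number β < k−1. Then for every ε > 0 there exists N such that for all integers n ≥ N, the number of positive integers m with φ_k(m) = n satisfies N_φ^k(n) ≤ n / L_{k,β+1}(n)^{1−ε}. -/
/-- `L k β n = exp(log n · (log log log n)^β / (log log n)^k)` -/
noncomputable def L (k : ℕ) (β : ℝ) (n : ℝ) : ℝ :=
  Real.exp (Real.log n * (Real.log (Real.log (Real.log n))) ^ β / (Real.log (Real.log n)) ^ k)

theorem dyadic_count (i : ℕ) (Q : Finset ℕ) (hQ : ∀ p ∈ Q, p.Prime ∧ 2 ^ i ≤ p ∧ p < 2 ^ (i+1)) :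
    i * Q.card ≤ 2 ^ (i+2) := by
  have h1 : (2 ^ i) ^ Q.card ≤ ∏ p ∈ Q, p := by
    apply Finset.pow_card_le_prod
    intro p hp; exact (hQ p hp).2.1
  have h2 : ∏ p ∈ Q, p ≤ primorial (2 ^ (i+1)) := by
    unfold primorial
    apply Finset.prod_le_prod_of_subset_of_one_le'
    · intro p hp
      obtain ⟨a, b, c⟩ := hQ p hp
      simp only [Finset.mem_filter, Finset.mem_range]
      exact ⟨by omega, a⟩
    · intro p hp _
      exact (Finset.mem_filter.1 hp).2.one_lt.le
  have h3 := primorial_le_four_pow (2 ^ (i+1))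
  have h4 : 2 ^ (i * Q.card) ≤ 2 ^ (2 ^ (i+2)) := by
    calc 2 ^ (i * Q.card) = (2 ^ i) ^ Q.card := by rw [pow_mul]
      _ ≤ 4 ^ (2 ^ (i+1)) := h1.trans (h2.trans h3)
      _ = (2 ^ 2) ^ (2 ^ (i+1)) := by norm_num
      _ = 2 ^ (2 ^ (i+2)) := by rw [← pow_mul]; congr 1; ring
  exact (Nat.pow_le_pow_iff_right (by norm_num)).1 h4

theorem recip_sum_nat (J : ℕ) (P : Finset ℕ) (hP : ∀ p ∈ P, p.Prime ∧ Nat.log 2 p ≤ J) :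
    ∑ p ∈ P, (p : ℝ)⁻¹ ≤ 4 * (1 + Real.log J) := by
  have hm : ∀ p ∈ P, Nat.log 2 p ∈ Finset.Icc 1 J := by
    intro p hp
    rw [Finset.mem_Icc]
    exact ⟨Nat.log_pos (by norm_num) (hP p hp).1.two_le, (hP p hp).2⟩
  rw [← Finset.sum_fiberwise_of_maps_to hm]
  have hi : ∀ i ∈ Finset.Icc 1 J, ∑ p ∈ P with Nat.log 2 p = i, (p : ℝ)⁻¹ ≤ 4 * (i : ℝ)⁻¹ := by
    intro i hi
    rw [Finset.mem_Icc] at hi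
    have hQ : ∀ p ∈ P.filter (fun p => Nat.log 2 p = i), p.Prime ∧ 2 ^ i ≤ p ∧ p < 2 ^ (i+1) := by
      intro p hp
      rw [Finset.mem_filter] at hp
      obtain ⟨h1, rfl⟩ := hp
      exact ⟨(hP p h1).1, Nat.pow_log_le_self 2 (hP p h1).1.ne_zero, Nat.lt_pow_succ_log_self (by norm_num) p⟩
    have hc := dyadic_count i _ hQ
    have h1 : ∑ p ∈ P with Nat.log 2 p = i, (p : ℝ)⁻¹ ≤ (P.filter (fun p => Nat.log 2 p = i)).card • ((2:ℝ)^i)⁻¹ := by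
      apply Finset.sum_le_card_nsmul
      intro p hp
      have := (hQ p hp).2.1
      have h' : (2:ℝ)^i ≤ p := by exact_mod_cast this
      gcongr
    refine h1.trans ?_
    rw [nsmul_eq_mul]
    have hc' : (i:ℝ) * ((P.filter (fun p => Nat.log 2 p = i)).card : ℝ) ≤ 2 ^ (i+2) := by exact_mod_cast hc
    have hi0 : (0:ℝ) < i := by exact_mod_cast hi.1
    rw [← div_eq_mul_inv, ← div_eq_mul_inv, div_le_div_iff₀ (by positivity) hi0]
    rw [pow_add] at hc'
    linarith
  refine (Finset.sum_le_sum hi).trans ?_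
  rw [← Finset.mul_sum]
  have := harmonic_le_one_add_log J
  rw [harmonic_eq_sum_Icc] at this
  push_cast at this
  linarith

theorem recip_sum_real (w : ℝ) (hw : 1 ≤ w) (P : Finset ℕ)
    (hP : ∀ p ∈ P, p.Prime ∧ (p : ℝ) ≤ Real.exp w) :
    ∑ p ∈ P, (p : ℝ)⁻¹ ≤ 8 + 4 * Real.log w := by
  have h := recip_sum_nat ⌊2 * w⌋₊ P ?_
  · refine h.trans ?_
    have h1 : Real.log (⌊2 * w⌋₊ : ℝ) ≤ Real.log (2 * w) := by
      apply Real.log_le_log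
      · have : 0 < ⌊2 * w⌋₊ := Nat.floor_pos.2 (by linarith)
        exact_mod_cast this
      · exact Nat.floor_le (by linarith)
    rw [Real.log_mul (by norm_num) (by linarith)] at h1
    have := Real.log_two_lt_d9
    linarith
  · intro p hp
    obtain ⟨h1, h2⟩ := hP p hp
    refine ⟨h1, Nat.le_floor ?_⟩
    have h3 : ((2:ℝ) ^ (Nat.log 2 p)) ≤ p := by exact_mod_cast Nat.pow_log_le_self 2 h1.ne_zero
    have h4 := Real.log_le_log (by positivity) (h3.trans h2)
    rw [Real.log_exp, Real.log_pow] at h4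
    have := Real.log_two_gt_d9
    have h5 : (0:ℝ) ≤ Nat.log 2 p := by positivity
    nlinarith

theorem prime_rpow_le {p : ℕ} (hp : p.Prime) {c : ℝ} (hc : 1/2 ≤ c) : (p : ℝ) ^ (-c) ≤ 3/4 := by
  have h2 : (2:ℝ) ≤ p := by exact_mod_cast hp.two_le
  calc (p : ℝ) ^ (-c) ≤ (p:ℝ) ^ (-(1/2) : ℝ) := by
        apply Real.rpow_le_rpow_of_exponent_le <;> linarith
    _ ≤ (2:ℝ) ^ (-(1/2) : ℝ) := by
        apply Real.rpow_le_rpow_of_nonpos <;> linarith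
    _ ≤ 3/4 := by
        rw [Real.rpow_neg (by norm_num), ← Real.sqrt_eq_rpow]
        have : (4/3 : ℝ) ≤ √2 := by
          apply Real.le_sqrt_of_sq_le; norm_num
        calc (√2)⁻¹ ≤ (4/3 : ℝ)⁻¹ := by gcongr
          _ = 3/4 := by norm_num

theorem inv_one_sub_le_exp {x : ℝ} (h0 : 0 ≤ x) (h1 : x ≤ 3/4) : (1 - x)⁻¹ ≤ Real.exp (4 * x) := by
  rw [inv_le_iff_one_le_mul₀' (by linarith)]
  have := Real.add_one_le_exp (4 * x)
  nlinarith

theorem euler_bound {c : ℝ} (hc : 1/2 ≤ c) (P A : Finset ℕ) (hP : ∀ p ∈ P, p.Prime)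
    (hA : ∀ a ∈ A, a ≠ 0 ∧ a.primeFactors ⊆ P) :
    ∑ a ∈ A, (a : ℝ) ^ (-c) ≤ Real.exp (4 * ∑ p ∈ P, (p : ℝ) ^ (-c)) := by
  let f : ℕ →* ℝ :=
    { toFun := fun a => (a : ℝ) ^ (-c)
      map_one' := by simp
      map_mul' := by
        intro a b
        push_cast
        exact Real.mul_rpow (by positivity) (by positivity) }
  have hf : ∀ a : ℕ, f a = (a : ℝ) ^ (-c) := fun a => rfl
  have hlt : ∀ {p : ℕ}, p.Prime → ‖f p‖ < 1 := by
    intro p hp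
    rw [hf, Real.norm_of_nonneg (by positivity)]
    have := prime_rpow_le hp hc
    linarith
  obtain ⟨-, hs⟩ := EulerProduct.summable_and_hasSum_factoredNumbers_prod_filter_prime_geometric hlt P
  have hmem : ∀ a : A, (a : ℕ) ∈ Nat.factoredNumbers P := fun a =>
    Nat.mem_factoredNumbers_iff_primeFactors_subset.2 (hA a a.2)
  have h1 : ∑ a ∈ A, f a ≤ ∏ p ∈ P with p.Prime, (1 - f p)⁻¹ := by
    let g : A → Nat.factoredNumbers P := fun a => ⟨a, hmem a⟩
    have hg : Function.Injective g := by
      intro a b hab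
      apply Subtype.ext
      exact congrArg (fun x : Nat.factoredNumbers P => (x : ℕ)) hab
    have := sum_le_hasSum (Finset.univ.image g) (fun i _ => by
      show 0 ≤ f i
      rw [hf]; positivity) hs
    rw [Finset.sum_image (fun a _ b _ h => hg h)] at this
    rw [← Finset.sum_coe_sort]
    exact this
  simp only [hf] at h1
  refine h1.trans ?_
  rw [Finset.filter_true_of_mem hP, Finset.mul_sum, Real.exp_sum]
  apply Finset.prod_le_prod
  · intro p hp
    have := prime_rpow_le (hP p hp) hc
    exact inv_nonneg.2 (by linarith)
  · intro p hp
    exact inv_one_sub_le_exp (by positivity) (prime_rpow_le (hP p hp) hc)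

theorem iter_dvd (k : ℕ) {a b : ℕ} (h : a ∣ b) : Nat.totient^[k] a ∣ Nat.totient^[k] b := by
  induction k generalizing a b with
  | zero => simpa using h
  | succ k ih =>
    rw [Function.iterate_succ_apply, Function.iterate_succ_apply]
    exact ih (Nat.totient_dvd_of_dvd h)

/-- The sum over primes with `φ_j(p) ∣ n` of `p^{-c}` is at most `B`. -/
def TBound (n j : ℕ) (c B : ℝ) : Prop :=
  ∀ P : Finset ℕ, (∀ p ∈ P, p.Prime ∧ Nat.totient^[j] p ∣ n) → ∑ p ∈ P, (p : ℝ) ^ (-c) ≤ B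

theorem sum_of_TBound {n j : ℕ} {c B : ℝ} (hc : 1/2 ≤ c) (h : TBound n j c B) (A : Finset ℕ)
    (hA : ∀ a ∈ A, a ≠ 0 ∧ Nat.totient^[j] a ∣ n) :
    ∑ a ∈ A, (a : ℝ) ^ (-c) ≤ Real.exp (4 * B) := by
  let P := A.biUnion Nat.primeFactors
  have hP : ∀ p ∈ P, p.Prime ∧ Nat.totient^[j] p ∣ n := by
    intro p hp
    obtain ⟨a, ha, hpa⟩ := Finset.mem_biUnion.1 hp
    exact ⟨Nat.prime_of_mem_primeFactors hpa,
      (iter_dvd j (Nat.dvd_of_mem_primeFactors hpa)).trans (hA a ha).2⟩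
  refine (euler_bound hc P A (fun p hp => (hP p hp).1) fun a ha =>
    ⟨(hA a ha).1, Finset.subset_biUnion_of_mem _ ha⟩).trans ?_
  gcongr
  exact h P hP

theorem TBound_succ {n j : ℕ} {c B : ℝ} (hc : 1/2 ≤ c) (h : TBound n j c B) :
    TBound n (j+1) c (Real.exp (4 * B)) := by
  intro P hP
  have hinj : Set.InjOn (fun p : ℕ => p - 1) P := by
    intro a ha b hb hab
    have h1 := (hP a ha).1.two_le
    have h2 := (hP b hb).1.two_le
    simp only at hab
    omega
  refine le_trans ?_ (sum_of_TBound hc h (P.image (fun p => p - 1)) ?_)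
  · rw [Finset.sum_image hinj]
    apply Finset.sum_le_sum
    intro p hp
    have h1 := (hP p hp).1.two_le
    apply Real.rpow_le_rpow_of_nonpos
    · have : 0 < p - 1 := by omega
      exact_mod_cast this
    · exact_mod_cast Nat.sub_le p 1
    · linarith
  · intro a ha
    obtain ⟨p, hp, rfl⟩ := Finset.mem_image.1 ha
    obtain ⟨h1, h2⟩ := hP p hp
    rw [Function.iterate_succ_apply, Nat.totient_prime h1] at h2
    exact ⟨by have := h1.two_le; omega, h2⟩

theorem le_totient_mul {n j m : ℕ} {c B : ℝ} (hc : 1/2 ≤ c) (hc1 : c ≤ 1) (h : TBound n j c B)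
    (hm : Nat.totient^[j] m ∣ n) : (m : ℝ) ≤ Nat.totient m * Real.exp (4 * B) := by
  have h1 : ((Nat.totient m : ℚ) : ℝ) = ((m * ∏ p ∈ m.primeFactors, (1 - (p : ℚ)⁻¹) : ℚ) : ℝ) := by
    rw [Nat.totient_eq_mul_prod_factors]
  push_cast at h1
  have hpos : ∀ p ∈ m.primeFactors, 0 < 1 - (p : ℝ)⁻¹ := by
    intro p hp
    have := prime_rpow_le (c := 1) (Nat.prime_of_mem_primeFactors hp) (by norm_num)
    rw [Real.rpow_neg_one] at this
    linarith
  have h2 : (∏ p ∈ m.primeFactors, (1 - (p : ℝ)⁻¹))⁻¹ ≤ Real.exp (4 * B) := by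
    rw [← Finset.prod_inv_distrib]
    calc ∏ p ∈ m.primeFactors, (1 - (p : ℝ)⁻¹)⁻¹ ≤ ∏ p ∈ m.primeFactors, Real.exp (4 * (p:ℝ) ^ (-c)) := by
          apply Finset.prod_le_prod
          · intro p hp; exact (inv_pos.2 (hpos p hp)).le
          · intro p hp
            have hpp := Nat.prime_of_mem_primeFactors hp
            have hle : (p : ℝ)⁻¹ ≤ (p:ℝ)^(-c) := by
              rw [← Real.rpow_neg_one]
              apply Real.rpow_le_rpow_of_exponent_le
              · exact_mod_cast hpp.one_lt.le
              · linarith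
            have h34 := prime_rpow_le hpp hc
            refine le_trans ?_ (inv_one_sub_le_exp (by positivity) h34)
            apply inv_anti₀ <;> linarith
      _ = Real.exp (4 * ∑ p ∈ m.primeFactors, (p:ℝ)^(-c)) := by
          rw [Finset.mul_sum, Real.exp_sum]
      _ ≤ Real.exp (4 * B) := by
          gcongr
          apply h
          intro p hp
          exact ⟨Nat.prime_of_mem_primeFactors hp, (iter_dvd j (Nat.dvd_of_mem_primeFactors hp)).trans hm⟩
  have hprod : 0 < ∏ p ∈ m.primeFactors, (1 - (p : ℝ)⁻¹) := Finset.prod_pos hpos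
  calc (m:ℝ) = Nat.totient m * (∏ p ∈ m.primeFactors, (1 - (p : ℝ)⁻¹))⁻¹ := by
        rw [h1, mul_inv_cancel_right₀ hprod.ne']
    _ ≤ _ := by gcongr

theorem le_of_iter {n k m : ℕ} {c E : ℝ} (hc : 1/2 ≤ c) (hc1 : c ≤ 1)
    (h : ∀ j ≤ k, TBound n j c E) (hm : Nat.totient^[k] m = n) :
    (m : ℝ) ≤ n * Real.exp (4 * k * E) := by
  induction k generalizing m with
  | zero => simp at hm; simp [hm]
  | succ k ih =>
    have h1 := le_totient_mul hc hc1 (h (k+1) le_rfl) (dvd_of_eq hm)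
    rw [Function.iterate_succ_apply] at hm
    have h2 := ih (fun j hj => h j (by omega)) hm
    calc (m:ℝ) ≤ Nat.totient m * Real.exp (4 * E) := h1
      _ ≤ (n * Real.exp (4 * k * E)) * Real.exp (4 * E) := by gcongr
      _ = n * Real.exp (4 * ((k+1 : ℕ) : ℝ) * E) := by
        rw [mul_assoc, ← Real.exp_add]; congr 2; push_cast; ring

theorem count_bound {n k : ℕ} {c E : ℝ} (hn : 0 < n) (hE : 0 ≤ E) (hc : 1/2 ≤ c) (hc1 : c ≤ 1)
    (h : ∀ j ≤ k, TBound n j c E) :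
    (Set.ncard {m : ℕ | 0 < m ∧ Nat.totient^[k] m = n} : ℝ) ≤
      (n : ℝ) ^ c * Real.exp (4 * (k + 1) * E) := by
  set S := {m : ℕ | 0 < m ∧ Nat.totient^[k] m = n} with hS
  have hle : ∀ m ∈ S, (m : ℝ) ≤ n * Real.exp (4 * k * E) := fun m hm => le_of_iter hc hc1 h hm.2
  have hfin : S.Finite := by
    apply (Set.finite_Iic ⌊(n:ℝ) * Real.exp (4 * k * E)⌋₊).subset
    intro m hm
    exact Nat.le_floor (hle m hm)
  rw [Set.ncard_eq_toFinset_card S hfin]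
  have hn' : (0:ℝ) < n := by exact_mod_cast hn
  have h1 : ((hfin.toFinset.card : ℕ) : ℝ) ≤
      ∑ m ∈ hfin.toFinset, ((n:ℝ) * Real.exp (4 * k * E)) ^ c * (m:ℝ) ^ (-c) := by
    rw [Finset.card_eq_sum_ones]
    push_cast
    apply Finset.sum_le_sum
    intro m hm
    rw [Set.Finite.mem_toFinset] at hm
    have hm0 : (0:ℝ) < m := by exact_mod_cast hm.1
    calc (1:ℝ) = (m:ℝ)^c * (m:ℝ)^(-c) := by rw [← Real.rpow_add hm0]; simp
      _ ≤ _ := by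
        gcongr
        exact hle m hm
  refine h1.trans ?_
  rw [← Finset.mul_sum]
  have h2 := sum_of_TBound hc (h k le_rfl) hfin.toFinset (by
    intro a ha
    rw [Set.Finite.mem_toFinset] at ha
    exact ⟨ha.1.ne', dvd_of_eq ha.2⟩)
  have h3 : Real.exp (4 * k * E) ^ c ≤ Real.exp (4 * k * E) := by
    rw [← Real.exp_mul]
    apply Real.exp_le_exp.2
    have : 0 ≤ 4 * k * E := by positivity
    nlinarith
  rw [Real.mul_rpow hn'.le (Real.exp_pos _).le]
  calc (n:ℝ)^c * Real.exp (4 * k * E) ^ c * ∑ m ∈ hfin.toFinset, (m:ℝ) ^ (-c)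
      ≤ (n:ℝ)^c * Real.exp (4 * k * E) * Real.exp (4 * E) := by gcongr
    _ = _ := by rw [mul_assoc, ← Real.exp_add]; congr 2; ring

theorem small_primes {c w : ℝ} (hc1 : c ≤ 1) (hw : 1 ≤ w) (P : Finset ℕ)
    (hP : ∀ p ∈ P, p.Prime ∧ (p : ℝ) ≤ Real.exp w) :
    ∑ p ∈ P, (p : ℝ) ^ (-c) ≤ Real.exp (w * (1 - c)) * (8 + 4 * Real.log w) := by
  refine le_trans ?_ (mul_le_mul_of_nonneg_left (recip_sum_real w hw P hP) (Real.exp_pos _).le)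
  rw [Finset.mul_sum]
  apply Finset.sum_le_sum
  intro p hp
  have hp0 : (0:ℝ) < p := by exact_mod_cast (hP p hp).1.pos
  rw [Real.exp_mul]
  calc (p:ℝ)^(-c) = (p:ℝ)^(1-c) * (p:ℝ)⁻¹ := by
        rw [← Real.rpow_neg_one, ← Real.rpow_add hp0]; congr 1; ring
    _ ≤ _ := by
      refine mul_le_mul_of_nonneg_right ?_ (by positivity)
      exact Real.rpow_le_rpow hp0.le (hP p hp).2 (by linarith)

theorem TBound_step {n j : ℕ} {η B : ℝ} (hη : 0 < η) (hη1 : η ≤ 1/2) (hB : 1 ≤ B)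
    (h : ∀ c, 1 - η ≤ c → c ≤ 1 → TBound n j c B)
    (hlog : Real.exp 1 * (8 + 4 * Real.log (8 * B / η)) + 1 ≤ B) :
    ∀ c, 1 - η / (8 * B) ≤ c → c ≤ 1 → TBound n (j+1) c B := by
  intro c hc hc1 P hP
  set w := 8 * B / η with hw
  have hw1 : 1 ≤ w := by rw [hw, le_div_iff₀ hη]; linarith
  have hwc : w * (1 - c) ≤ 1 := by
    have : 1 - c ≤ η / (8 * B) := by linarith
    calc w * (1 - c) ≤ w * (η / (8 * B)) := by gcongr
      _ = 1 := by rw [hw]; field_simp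
  have hc2 : 1 - η / 2 ≤ c := by
    have : η / (8 * B) ≤ η / 2 := by gcongr; linarith
    linarith
  rw [← Finset.sum_filter_add_sum_filter_not P (fun p : ℕ => (p:ℝ) ≤ Real.exp w)]
  refine le_trans (add_le_add ?_ ?_) hlog
  · refine (small_primes hc1 hw1 _ ?_).trans ?_
    · intro p hp
      rw [Finset.mem_filter] at hp
      exact ⟨(hP p hp.1).1, hp.2⟩
    · have := Real.log_nonneg hw1
      gcongr
  · have hT := TBound_succ (by linarith) (h (c - η/2) (by linarith) (by linarith))
    have h2 := hT (P.filter (fun p : ℕ => ¬ (p:ℝ) ≤ Real.exp w)) (fun p hp => hP p (Finset.mem_filter.1 hp).1)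
    have h3 : ∑ p ∈ P.filter (fun p : ℕ => ¬ (p:ℝ) ≤ Real.exp w), (p : ℝ) ^ (-c) ≤
        ∑ p ∈ P.filter (fun p : ℕ => ¬ (p:ℝ) ≤ Real.exp w), Real.exp (-(4*B)) * (p : ℝ) ^ (-(c - η/2)) := by
      apply Finset.sum_le_sum
      intro p hp
      rw [Finset.mem_filter, not_le] at hp
      have hp0 : (0:ℝ) < p := (Real.exp_pos _).trans hp.2
      have : (p:ℝ)^(-(η/2)) ≤ Real.exp (-(4*B)) := by
        calc (p:ℝ)^(-(η/2)) ≤ (Real.exp w)^(-(η/2)) := by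
              apply Real.rpow_le_rpow_of_nonpos (Real.exp_pos _) hp.2.le; linarith
          _ = Real.exp (-(4*B)) := by
              rw [← Real.exp_mul]; congr 1; rw [hw]; field_simp; ring
      calc (p:ℝ)^(-c) = (p:ℝ)^(-(η/2)) * (p : ℝ) ^ (-(c - η/2)) := by
            rw [← Real.rpow_add hp0]; congr 1; ring
        _ ≤ _ := by gcongr
    refine h3.trans ?_
    rw [← Finset.mul_sum]
    calc _ ≤ Real.exp (-(4*B)) * Real.exp (4*B) := by gcongr
      _ = 1 := by rw [← Real.exp_add]; simp

/-- base case; `x = log log n`. -/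
theorem TBound_zero {n : ℕ} {x η B : ℝ} (hn : 0 < n) (hx : 1 ≤ x) (hnx : Real.log n = Real.exp x)
    (hη1 : η ≤ 1)
    (hlog : Real.exp (x * η) * (10 + 4 * Real.log x) ≤ B) :
    ∀ c, 1 - η ≤ c → c ≤ 1 → TBound n 0 c B := by
  intro c hc hc1 P hP
  rw [← Finset.sum_filter_add_sum_filter_not P (fun p : ℕ => (p:ℝ) ≤ Real.exp x)]
  have hlx := Real.log_nonneg hx
  have hexp : Real.exp (x * (1 - c)) ≤ Real.exp (x * η) := by
    gcongr; linarith
  have hA : ∑ p ∈ P.filter (fun p : ℕ => (p:ℝ) ≤ Real.exp x), (p : ℝ) ^ (-c) ≤ Real.exp (x * η) * (8 + 4 * Real.log x) := by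
    refine (small_primes hc1 hx _ ?_).trans ?_
    · intro p hp
      rw [Finset.mem_filter] at hp
      exact ⟨(hP p hp.1).1, hp.2⟩
    · gcongr
  have hB : ∑ p ∈ P.filter (fun p : ℕ => ¬ (p:ℝ) ≤ Real.exp x), (p : ℝ) ^ (-c) ≤ 2 * Real.exp (x * η) := by
    set Q := P.filter (fun p : ℕ => ¬ (p:ℝ) ≤ Real.exp x) with hQ
    have hcard : (Q.card : ℝ) ≤ 2 * Real.exp x := by
      have h1 : 2 ^ Q.card ≤ ∏ p ∈ Q, p := by
        apply Finset.pow_card_le_prod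
        intro p hp; exact (hP p (Finset.mem_filter.1 hp).1).1.two_le
      have h2 : ∏ p ∈ Q, p ∣ n := by
        apply Finset.prod_primes_dvd
        · intro p hp; exact (hP p (Finset.mem_filter.1 hp).1).1.prime
        · intro p hp; simpa using (hP p (Finset.mem_filter.1 hp).1).2
      have h3 : ((2:ℝ) ^ Q.card) ≤ n := by exact_mod_cast h1.trans (Nat.le_of_dvd hn h2)
      have h4 := Real.log_le_log (by positivity) h3
      rw [Real.log_pow, hnx] at h4
      have := Real.log_two_gt_d9
      have h5 : (0:ℝ) ≤ Q.card := by positivity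
      nlinarith
    calc ∑ p ∈ Q, (p : ℝ) ^ (-c) ≤ Q.card • Real.exp (x * (-c)) := by
          apply Finset.sum_le_card_nsmul
          intro p hp
          rw [hQ, Finset.mem_filter, not_le] at hp
          rw [Real.exp_mul]
          apply Real.rpow_le_rpow_of_nonpos (Real.exp_pos _) hp.2.le; linarith
      _ ≤ 2 * Real.exp x * Real.exp (x * (-c)) := by rw [nsmul_eq_mul]; gcongr
      _ = 2 * Real.exp (x * (1 - c)) := by rw [mul_assoc, ← Real.exp_add]; congr 2; ring
      _ ≤ _ := by gcongr
  nlinarith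

open Filter in
theorem ev_log (A C r : ℝ) (hr : 0 < r) : ∀ᶠ x : ℝ in atTop, A + C * Real.log x ≤ x ^ r := by
  have h1 : (fun x : ℝ => A + C * Real.log x) =o[atTop] (fun x : ℝ => x ^ r) := by
    apply Asymptotics.IsLittleO.add
    · exact Asymptotics.isLittleO_const_left.2 (Or.inr
        (tendsto_norm_atTop_atTop.comp (tendsto_rpow_atTop hr)))
    · exact (isLittleO_log_rpow_atTop hr).const_mul_left C
  filter_upwards [h1.bound one_pos, eventually_ge_atTop 0] with x hx hx0
  rw [one_mul, Real.norm_of_nonneg (Real.rpow_nonneg hx0 r)] at hx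
  exact (le_abs_self _).trans hx

theorem main_n (k' n : ℕ) (x b : ℝ) (hn : 0 < n) (hnx : Real.log n = Real.exp x)
    (hx : 1 ≤ x) (hlx : 1 ≤ Real.log x)
    (h1 : 10 + 4 * Real.log x ≤ x ^ (1/8 : ℝ))
    (h2 : (Real.exp 1 * (8 + 4 * (k'+1) * Real.log 8) + 1) + (Real.exp 1 * (4 * (k'+1))) * Real.log x
      ≤ x ^ (1/4 : ℝ))
    (h3 : 0 + 8 * Real.log x ≤ x ^ (3/4 : ℝ))
    (h4 : 16 ≤ (Real.log x) ^ ((k' + 1 : ℝ) - b))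
    (h5 : 64 * (k' + 2) * x ^ (k' + 1) ≤ Real.exp (x / 2)) :
    (Set.ncard {m : ℕ | 0 < m ∧ Nat.totient^[k'+1] m = n} : ℝ) ≤
      n * Real.exp (- (Real.exp x * (Real.log x) ^ b / x ^ (k'+1))) := by
  set B : ℝ := x ^ (1/4 : ℝ) with hBdef
  set η₀ : ℝ := Real.log x / (8 * x) with hη₀
  have hx0 : 0 < x := by linarith
  have hB : 1 ≤ B := Real.one_le_rpow hx (by norm_num)
  have hBx : B ≤ x := by
    calc B ≤ x ^ (1:ℝ) := Real.rpow_le_rpow_of_exponent_le hx (by norm_num)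
      _ = x := Real.rpow_one x
  have hlogx : Real.log x ≤ x := (Real.log_le_sub_one_of_pos hx0).trans (by linarith)
  have h8 : 8 * B * Real.log x ≤ x := by
    calc 8 * B * Real.log x = B * (0 + 8 * Real.log x) := by ring
      _ ≤ B * x ^ (3/4 : ℝ) := by gcongr
      _ = x := by rw [hBdef, ← Real.rpow_add hx0]; norm_num
  have h8B : 8 * B ≤ x := by nlinarith
  have hη₀pos : 0 < η₀ := by positivity
  have hη₀half : η₀ ≤ 1/2 := by
    rw [hη₀, div_le_iff₀ (by positivity)]; linarith
  have hpow1 : ∀ j : ℕ, 1 ≤ (8 * B) ^ j := fun j => one_le_pow₀ (by linarith)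
  have key : ∀ j ≤ k', ∀ c, 1 - η₀ / (8 * B) ^ j ≤ c → c ≤ 1 → TBound n j c B := by
    intro j
    induction j with
    | zero =>
      intro _
      simp only [pow_zero, div_one]
      apply TBound_zero hn hx hnx (by linarith)
      have : Real.exp (x * η₀) = x ^ (1/8 : ℝ) := by
        rw [Real.rpow_def_of_pos hx0]; congr 1; rw [hη₀]; field_simp
      rw [this]
      calc x ^ (1/8 : ℝ) * (10 + 4 * Real.log x) ≤ x ^ (1/8 : ℝ) * x ^ (1/8 : ℝ) := by gcongr
        _ = B := by rw [hBdef, ← Real.rpow_add hx0]; norm_num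
    | succ j ih =>
      intro hj
      have hη : 0 < η₀ / (8 * B) ^ j := by positivity
      have hstep := TBound_step (n := n) (j := j) hη
        ((div_le_self hη₀pos.le (hpow1 j)).trans hη₀half) hB (ih (by omega)) ?_
      · rw [div_div, ← pow_succ] at hstep
        exact hstep
      · have hle : 8 * B / (η₀ / (8 * B) ^ j) ≤ (8 * x) ^ (k' + 1) := by
          calc 8 * B / (η₀ / (8 * B) ^ j) = (8 * B) ^ (j+1) * (8 * x) / Real.log x := by
                rw [hη₀]; field_simp; ring
            _ ≤ (8 * B) ^ (j+1) * (8 * x) := div_le_self (by positivity) hlx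
            _ ≤ (8 * x) ^ (j+1) * (8 * x) := by gcongr
            _ = (8 * x) ^ (j + 2) := by ring
            _ ≤ (8 * x) ^ (k' + 1) := pow_le_pow_right₀ (by linarith) (by omega)
        have hlog := Real.log_le_log (by positivity) hle
        rw [Real.log_pow, Real.log_mul (by norm_num) hx0.ne'] at hlog
        push_cast at hlog
        have he := Real.exp_pos 1
        calc _ ≤ Real.exp 1 * (8 + 4 * ((k'+1) * (Real.log 8 + Real.log x))) + 1 := by gcongr
          _ = _ := by ring
          _ ≤ _ := h2
  set η := η₀ / (8 * B) ^ k' with hη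
  have hηpos : 0 < η := by positivity
  have hηhalf : η ≤ 1/2 := (div_le_self hη₀pos.le (hpow1 k')).trans hη₀half
  have hBE : B ≤ Real.exp (4 * B) := by
    have := Real.add_one_le_exp (4 * B); linarith
  have hT : ∀ j ≤ k' + 1, TBound n j (1 - η) (Real.exp (4 * B)) := by
    intro j hj
    rcases Nat.lt_or_ge k' j with h | h
    · obtain rfl : j = k' + 1 := by omega
      exact TBound_succ (by linarith) (key k' le_rfl _ le_rfl (by linarith))
    · intro P hP
      refine (key j h (1 - η) ?_ (by linarith) P hP).trans hBE
      have : η ≤ η₀ / (8 * B) ^ j := by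
        rw [hη]; gcongr; linarith
      linarith
  have hmain := count_bound hn (Real.exp_pos _).le (by linarith) (by linarith) hT
  refine hmain.trans ?_
  have hn0 : (0:ℝ) < n := by exact_mod_cast hn
  have hpown : (n:ℝ) ^ (1 - η) = n * Real.exp (-(η * Real.exp x)) := by
    rw [Real.rpow_sub hn0, Real.rpow_one, Real.rpow_def_of_pos hn0, hnx, div_eq_mul_inv, ← Real.exp_neg]
    congr 3; ring
  rw [hpown, mul_assoc, ← Real.exp_add]
  gcongr
  -- lower bound for η
  have hη_lower : 1 / (8 * x ^ (k'+1)) ≤ η := by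
    rw [hη, hη₀, div_div]
    apply div_le_div₀ (by linarith) hlx (by positivity)
    calc 8 * x * (8 * B) ^ k' ≤ 8 * x * x ^ k' := by gcongr
      _ = _ := by ring
  have hf : 4 * ((k' + 1 : ℕ) + 1 : ℝ) * Real.exp (4 * B) ≤ η / 2 * Real.exp x := by
    have e1 : Real.exp (4 * B) ≤ Real.exp (x / 2) := by
      apply Real.exp_le_exp.2; linarith
    have e2 : Real.exp x = Real.exp (x/2) * Real.exp (x/2) := by rw [← Real.exp_add]; congr 1; ring
    have hxk : 0 < x ^ (k'+1) := by positivity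
    calc 4 * ((k' + 1 : ℕ) + 1 : ℝ) * Real.exp (4 * B)
        ≤ 4 * ((k' + 1 : ℕ) + 1 : ℝ) * Real.exp (x / 2) := by gcongr
      _ = 1 / (8 * x ^ (k'+1)) / 2 * ((64 * (k' + 2) * x ^ (k' + 1)) * Real.exp (x/2)) := by
          push_cast; field_simp; ring
      _ ≤ 1 / (8 * x ^ (k'+1)) / 2 * (Real.exp (x/2) * Real.exp (x/2)) := by gcongr
      _ = 1 / (8 * x ^ (k'+1)) / 2 * Real.exp x := by rw [e2]
      _ ≤ _ := by gcongr
  have hlx0 : 0 < Real.log x := by linarith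
  have he : (Real.log x) ^ b / x ^ (k'+1) ≤ η / 2 := by
    have e1 : 16 * (Real.log x) ^ b ≤ (Real.log x) ^ (k'+1) := by
      calc 16 * (Real.log x) ^ b ≤ (Real.log x) ^ ((k' + 1 : ℝ) - b) * (Real.log x) ^ b := by gcongr
        _ = (Real.log x) ^ (k'+1) := by
          rw [← Real.rpow_add hlx0, ← Real.rpow_natCast]; congr 1; push_cast; ring
    have e2 : (8 * B) ^ k' * (Real.log x) ^ k' ≤ x ^ k' := by
      rw [← mul_pow]; gcongr
    rw [hη, hη₀, div_div, div_div, div_le_div_iff₀ (by positivity) (by positivity)]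
    calc (Real.log x) ^ b * (8 * x * ((8 * B) ^ k' * 2))
        = (16 * (Real.log x) ^ b) * (x * (8 * B) ^ k') := by ring
      _ ≤ (Real.log x) ^ (k'+1) * (x * (8 * B) ^ k') := by gcongr
      _ = Real.log x * x * ((8 * B) ^ k' * (Real.log x) ^ k') := by ring
      _ ≤ Real.log x * x * x ^ k' := by gcongr
      _ = _ := by ring
  have := mul_le_mul_of_nonneg_left he (Real.exp_pos x).le
  rw [← mul_div_assoc] at this
  linarith

theorem totient_iterate_preimage_count (k : ℕ) (hk : 0 < k) (β : ℝ) (hβ : β < (k : ℝ) - 1) :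
    ∀ ε : ℝ, 0 < ε → ∃ N : ℕ, ∀ n : ℕ, N ≤ n →
      (Set.ncard {m : ℕ | 0 < m ∧ Nat.totient^[k] m = n} : ℝ) ≤
        (n : ℝ) / (L k (β + 1) n) ^ ((1 : ℝ) - ε) := by
  intro ε hε
  obtain ⟨k', rfl⟩ : ∃ k', k = k' + 1 := ⟨k - 1, by omega⟩
  push_cast at hβ
  have hlogt := Real.tendsto_log_atTop
  have hloglog : Filter.Tendsto (fun n : ℕ => Real.log (Real.log (n:ℝ))) Filter.atTop Filter.atTop :=
    hlogt.comp (hlogt.comp tendsto_natCast_atTop_atTop)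
  have hlog1 : Filter.Tendsto (fun n : ℕ => Real.log (n:ℝ)) Filter.atTop Filter.atTop :=
    hlogt.comp tendsto_natCast_atTop_atTop
  have E4 : ∀ᶠ x : ℝ in Filter.atTop, 16 ≤ (Real.log x) ^ ((k' + 1 : ℝ) - (β + 1)) :=
    ((tendsto_rpow_atTop (by linarith)).comp hlogt).eventually_ge_atTop 16
  have E5 : ∀ᶠ x : ℝ in Filter.atTop, 64 * (k' + 2) * x ^ (k' + 1) ≤ Real.exp (x / 2) := by
    have h := (isLittleO_pow_exp_pos_mul_atTop (k'+1) (b := 1/2) (by norm_num)).const_mul_left (64 * (k' + 2 : ℝ))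
    filter_upwards [h.bound one_pos] with x hx
    rw [one_mul, Real.norm_of_nonneg (Real.exp_pos _).le] at hx
    refine (le_abs_self _).trans (hx.trans (le_of_eq ?_))
    congr 1; ring
  have E : ∀ᶠ n : ℕ in Filter.atTop,
      (Set.ncard {m : ℕ | 0 < m ∧ Nat.totient^[k'+1] m = n} : ℝ) ≤
        (n : ℝ) / (L (k'+1) (β + 1) n) ^ ((1 : ℝ) - ε) := by
    filter_upwards [Filter.eventually_gt_atTop 0, hlog1.eventually_gt_atTop 0,
      hloglog.eventually (Filter.eventually_ge_atTop 1),
      hloglog.eventually (hlogt.eventually_ge_atTop 1),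
      hloglog.eventually (ev_log 10 4 (1/8) (by norm_num)),
      hloglog.eventually (ev_log (Real.exp 1 * (8 + 4 * (k'+1) * Real.log 8) + 1)
        (Real.exp 1 * (4 * (k'+1))) (1/4) (by norm_num)),
      hloglog.eventually (ev_log 0 8 (3/4) (by norm_num)),
      hloglog.eventually E4, hloglog.eventually E5] with n hn hl hx hlx h1 h2 h3 h4 h5
    have hmain := main_n k' n (Real.log (Real.log n)) (β + 1) hn (Real.exp_log hl).symm hx hlx h1 h2 h3 h4 h5
    rw [Real.exp_log hl] at hmain
    refine hmain.trans ?_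
    unfold L
    rw [← Real.exp_mul, div_eq_mul_inv (n : ℝ), ← Real.exp_neg]
    gcongr
    have ht : 0 ≤ Real.log n * (Real.log (Real.log (Real.log n))) ^ (β + 1) /
        (Real.log (Real.log n)) ^ (k' + 1) := by positivity
    nlinarith
  exact Filter.eventually_atTop.1 E
end

section
/- Fix an integer k ≥ 1 and a real number α. For every ε > 0 there exists x₀ such that for all x ≥ x₀, setting z = exp((log log x)^{1/2}), the number of positive integers m ≤ x with Ω_{>z}(φ(m)) ≥ log L_{k+1,α}(x) is at most x / L_{k+1,α+1}(x)^{1−ε}. -/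
open Classical in
/-- `Ω_{>z}(n)`: the number of prime factors of `n` exceeding `z`, counted with
multiplicity. -/
noncomputable def OmegaGt (z : ℝ) (n : ℕ) : ℕ :=
  ((n.primeFactorsList).filter (fun p => z < (p : ℝ))).length

open Classical in
lemma OmegaGt_eq (z : ℝ) (n : ℕ) :
    OmegaGt z n = ((n.primeFactorsList).filter (fun p : ℕ => decide (z < (p : ℝ)))).length := by
  unfold OmegaGt
  rw [bind_pure_comp, List.map_eq_map, List.filter_map, List.length_map]
  rfl

lemma OmegaGt_mul (z : ℝ) {m n : ℕ} (hm : m ≠ 0) (hn : n ≠ 0) :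
    OmegaGt z (m * n) = OmegaGt z m + OmegaGt z n := by
  classical
  simp only [OmegaGt_eq]
  rw [((Nat.perm_primeFactorsList_mul hm hn).filter _).length_eq, List.filter_append,
    List.length_append]

lemma OmegaGt_one (z : ℝ) : OmegaGt z 1 = 0 := by
  simp [OmegaGt]

lemma OmegaGt_pow (z : ℝ) {m : ℕ} (hm : m ≠ 0) (a : ℕ) :
    OmegaGt z (m ^ a) = a * OmegaGt z m := by
  induction a with
  | zero => simp [OmegaGt_one]
  | succ a ih => rw [pow_succ, OmegaGt_mul z (pow_ne_zero _ hm) hm, ih]; ring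

lemma pow_OmegaGt_prime_le {z C : ℝ} (hC : 1 ≤ C) (hCz : 2 * C ≤ z) {p : ℕ} (hp : p.Prime) :
    C ^ OmegaGt z p / p ≤ 1 / 2 ∧ C ^ OmegaGt z p ≤ C := by
  classical
  have h2 : (2 : ℝ) ≤ p := by exact_mod_cast hp.two_le
  have h0 : (0 : ℝ) < p := by linarith
  rw [OmegaGt_eq, Nat.primeFactorsList_prime hp]
  by_cases h : z < (p : ℝ)
  · simp only [h, decide_true, List.filter_cons_of_pos, List.filter_nil, List.length_singleton,
      pow_one, le_refl, and_true]
    rw [div_le_iff₀ h0]; linarith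
  · simp only [h, decide_false, Bool.false_eq_true, not_false_eq_true, List.filter_cons_of_neg,
      List.filter_nil, List.length_nil, pow_zero]
    refine ⟨?_, hC⟩
    rw [div_le_iff₀ h0]; linarith

lemma euler_bound_s16 (f A : ℕ → ℝ) (hf0 : ∀ n, 0 ≤ f n) (hf1 : f 1 = 1)
    (hmul : ∀ {m n : ℕ}, Nat.Coprime m n → f (m * n) = f m * f n)
    (hA : ∀ p : ℕ, p.Prime → ∀ a : ℕ, f (p ^ (a + 1)) ≤ A p * (1 / 2) ^ a) (N : ℕ) :
    ∑ m ∈ Finset.Icc 1 N, f m ≤ Real.exp (2 * ∑ p ∈ (N + 1).primesBelow, A p) := by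
  have hg : ∀ p : ℕ, HasSum (fun a : ℕ => A p * (1 / 2 : ℝ) ^ a) (A p * 2) := fun p =>
    hasSum_geometric_two.mul_left _
  have hs1 : ∀ {p : ℕ}, p.Prime → Summable (fun a : ℕ => f (p ^ (a + 1))) := fun {p} hp =>
    Summable.of_nonneg_of_le (fun a => hf0 _) (hA p hp) (hg p).summable
  have hs : ∀ {p : ℕ}, p.Prime → Summable (fun a : ℕ => f (p ^ a)) := fun {p} hp =>
    (summable_nat_add_iff 1).1 (hs1 hp)
  have hsn : ∀ {p : ℕ}, p.Prime → Summable (fun a : ℕ => ‖f (p ^ a)‖) := fun {p} hp => (hs hp).norm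
  obtain ⟨_, H⟩ := EulerProduct.summable_and_hasSum_smoothNumbers_prod_primesBelow_tsum
    hf1 hmul hsn (N + 1)
  have h1 : ∑ m ∈ Finset.Icc 1 N, f m ≤ ∏ p ∈ (N + 1).primesBelow, ∑' a : ℕ, f (p ^ a) := by
    replace H := (hasSum_subtype_iff_indicator (f := f)).1 H
    refine le_trans ?_ (sum_le_hasSum (Finset.Icc 1 N)
      (fun i _ => Set.indicator_nonneg (fun n _ => hf0 n) i) H)
    refine Finset.sum_le_sum fun i hi => ?_
    rw [Finset.mem_Icc] at hi
    have hmem : i ∈ Nat.smoothNumbers (N + 1) :=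
      Nat.mem_smoothNumbers_of_lt (by omega) (by omega)
    simp [hmem]
  refine h1.trans ?_
  rw [Finset.mul_sum, Real.exp_sum]
  refine Finset.prod_le_prod (fun p _ => tsum_nonneg fun a => hf0 _) fun p hp => ?_
  have hp' := Nat.prime_of_mem_primesBelow hp
  rw [(hs hp').tsum_eq_zero_add]
  have h2 : ∑' a : ℕ, f (p ^ (a + 1)) ≤ A p * 2 :=
    hasSum_le (hA p hp') (hs1 hp').hasSum (hg p)
  have h3 := Real.add_one_le_exp (2 * A p)
  simp only [pow_zero, hf1]
  linarith

lemma zeta_partial {σ : ℝ} (hσ : 0 < σ) (N : ℕ) :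
    ∑ n ∈ Finset.range (N + 1), ((n + 1 : ℕ) : ℝ) ^ (-(1 + σ)) ≤
      1 + 1 / σ - ((N + 1 : ℕ) : ℝ) ^ (-σ) / σ := by
  induction N with
  | zero => simp
  | succ N ih =>
    rw [Finset.sum_range_succ]
    have hkey : (((N + 1) + 1 : ℕ) : ℝ) ^ (-(1 + σ)) ≤
        ((N + 1 : ℕ) : ℝ) ^ (-σ) / σ - (((N + 1) + 1 : ℕ) : ℝ) ^ (-σ) / σ := by
      set y : ℝ := (((N + 1) + 1 : ℕ) : ℝ) with hy
      have hy1 : ((N + 1 : ℕ) : ℝ) = y - 1 := by rw [hy]; push_cast; ring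
      have hy2 : 2 ≤ y := by rw [hy]; push_cast; linarith [(Nat.cast_nonneg N : (0 : ℝ) ≤ N)]
      have hy0 : 0 < y := by linarith
      rw [hy1]
      have e1 : y ^ (-(1 + σ)) = y ^ (-σ) * (1 / y) := by
        rw [show -(1 + σ) = -σ + -1 by ring, Real.rpow_add hy0, Real.rpow_neg_one, one_div]
      have hlt : 1 / y < 1 := by rw [div_lt_one hy0]; linarith
      have e2 : (y - 1) ^ (-σ) = y ^ (-σ) * (1 - 1 / y) ^ (-σ) := by
        rw [← Real.mul_rpow hy0.le (by linarith)]
        congr 1; field_simp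
      have e3 : 1 + σ * (1 / y) ≤ (1 - 1 / y) ^ (-σ) := by
        rw [Real.rpow_def_of_pos (by linarith)]
        have h1 := Real.log_le_sub_one_of_pos (show 0 < 1 - 1 / y by linarith)
        have h2 := Real.add_one_le_exp (Real.log (1 - 1 / y) * -σ)
        nlinarith
      have hp : 0 < y ^ (-σ) := Real.rpow_pos_of_pos hy0 _
      rw [e1, e2, ← sub_div, le_div_iff₀ hσ]
      nlinarith [mul_le_mul_of_nonneg_left e3 hp.le]
    linarith

lemma prime_sum_bound {σ : ℝ} (hσ : 0 < σ) (N : ℕ) :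
    ∑ p ∈ N.primesBelow, (p : ℝ) ^ (-(1 + σ)) ≤ Real.log (1 + 1 / σ) := by
  have hpos : 0 < 1 + 1 / σ := by positivity
  rw [Real.le_log_iff_exp_le hpos, Real.exp_sum]
  let f : ℕ → ℝ := fun n => (n : ℝ) ^ (-(1 + σ))
  have hf0 : ∀ n, 0 ≤ f n := fun n => by positivity
  have hpow : ∀ p a : ℕ, f (p ^ a) = (f p) ^ a := by
    intro p a
    simp only [f]
    push_cast
    rw [← Real.rpow_natCast, ← Real.rpow_natCast, ← Real.rpow_mul (by positivity),
      ← Real.rpow_mul (by positivity), mul_comm]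
  have hlt : ∀ {p : ℕ}, p.Prime → f p < 1 := fun {p} hp =>
    Real.rpow_lt_one_of_one_lt_of_neg (by exact_mod_cast hp.one_lt) (by linarith)
  have hs : ∀ {p : ℕ}, p.Prime → Summable (fun a : ℕ => ‖f (p ^ a)‖) := fun {p} hp => by
    simp_rw [hpow]
    exact (summable_geometric_of_lt_one (hf0 p) (hlt hp)).norm
  obtain ⟨_, H⟩ := EulerProduct.summable_and_hasSum_smoothNumbers_prod_primesBelow_tsum
    (f := f) (by simp [f])
    (fun {m n} _ => by simp only [f]; push_cast; rw [Real.mul_rpow (by positivity) (by positivity)])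
    hs N
  have hle : ∏ p ∈ N.primesBelow, Real.exp ((p : ℝ) ^ (-(1 + σ))) ≤
      ∏ p ∈ N.primesBelow, ∑' n : ℕ, f (p ^ n) := by
    refine Finset.prod_le_prod (fun p _ => (Real.exp_pos _).le) fun p hp => ?_
    have hp' := Nat.prime_of_mem_primesBelow hp
    simp_rw [hpow]
    rw [tsum_geometric_of_lt_one (hf0 p) (hlt hp')]
    have h1 := Real.add_one_le_exp (-(f p))
    have h2 : 0 < 1 - f p := by linarith [hlt hp']
    have : Real.exp (f p) = (Real.exp (-(f p)))⁻¹ := by rw [Real.exp_neg, inv_inv]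
    change Real.exp (f p) ≤ _
    rw [this]
    exact inv_anti₀ h2 (by linarith)
  refine hle.trans ?_
  replace H := (hasSum_subtype_iff_indicator (f := f)).1 H
  refine le_of_tendsto H.tendsto_sum_nat (Filter.Eventually.of_forall fun M => ?_)
  have h1 : ∑ i ∈ Finset.range M, (N.smoothNumbers).indicator f i ≤
      ∑ i ∈ Finset.range (M + 1 + 1), (N.smoothNumbers).indicator f i :=
    Finset.sum_le_sum_of_subset_of_nonneg (Finset.range_mono (by omega))
      (fun i _ _ => Set.indicator_nonneg (fun n _ => hf0 n) i)
  refine h1.trans ?_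
  rw [Finset.sum_range_succ']
  have h00 : (N.smoothNumbers).indicator f 0 = 0 := by
    apply Set.indicator_of_notMem
    intro h; exact Nat.ne_zero_of_mem_smoothNumbers h rfl
  rw [h00, add_zero]
  have h2 : ∑ i ∈ Finset.range (M + 1), (N.smoothNumbers).indicator f (i + 1) ≤
      ∑ n ∈ Finset.range (M + 1), ((n + 1 : ℕ) : ℝ) ^ (-(1 + σ)) :=
    Finset.sum_le_sum fun i _ => Set.indicator_le_self' (fun _ _ => hf0 _) _
  have h3 := zeta_partial hσ M
  have h4 : 0 ≤ ((M + 1 : ℕ) : ℝ) ^ (-σ) / σ := by positivity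
  linarith

lemma rpow_le_inv_nat {σ : ℝ} (hσ : 0 < σ) {p : ℕ} (hp : 1 ≤ p) :
    (p : ℝ) ^ (-(1 + σ)) ≤ 1 / p := by
  have h1 : (1 : ℝ) ≤ p := by exact_mod_cast hp
  rw [one_div, ← Real.rpow_neg_one]
  exact Real.rpow_le_rpow_of_exponent_le h1 (by linarith)

lemma ratio_le {z C σ : ℝ} (hC : 1 ≤ C) (hCz : 2 * C ≤ z) (hσ : 0 < σ) {p : ℕ} (hp : p.Prime) :
    C ^ OmegaGt z p * (p : ℝ) ^ (-(1 + σ)) ≤ 1 / 2 := by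
  refine le_trans ?_ (pow_OmegaGt_prime_le hC hCz hp).1
  rw [div_eq_mul_one_div]
  exact mul_le_mul_of_nonneg_left (rpow_le_inv_nat hσ hp.one_lt.le) (by positivity)

lemma cast_pow_rpow (p a : ℕ) (s : ℝ) : ((p ^ a : ℕ) : ℝ) ^ s = ((p : ℝ) ^ s) ^ a := by
  push_cast
  rw [← Real.rpow_natCast, ← Real.rpow_natCast, ← Real.rpow_mul (by positivity),
      ← Real.rpow_mul (by positivity), mul_comm]

lemma inner_bound {z C σ : ℝ} (hC : 1 ≤ C) (hCz : 2 * C ≤ z) (hσ : 0 < σ) (N : ℕ) :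
    ∑ n ∈ Finset.Icc 1 N, C ^ OmegaGt z n * (n : ℝ) ^ (-(1 + σ)) ≤
      Real.exp (2 * (C * Real.log (1 + 1 / σ))) := by
  have hC0 : 0 < C := by linarith
  have H := euler_bound_s16 (fun n => C ^ OmegaGt z n * (n : ℝ) ^ (-(1 + σ)))
    (fun p => C * (p : ℝ) ^ (-(1 + σ))) (fun n => by positivity) (by simp [OmegaGt_one])
    (by
      intro m n _
      rcases eq_or_ne m 0 with rfl | hm
      · simp [Real.zero_rpow (show -(1 + σ) ≠ 0 by linarith)]
        try simp [Real.zero_rpow (show -σ + -1 ≠ 0 by linarith)]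
      rcases eq_or_ne n 0 with rfl | hn
      · simp [Real.zero_rpow (show -(1 + σ) ≠ 0 by linarith)]
        try simp [Real.zero_rpow (show -σ + -1 ≠ 0 by linarith)]
      rw [OmegaGt_mul z hm hn, pow_add]
      push_cast
      rw [Real.mul_rpow (by positivity) (by positivity)]; ring)
    (by
      intro p hp a
      rw [OmegaGt_pow z hp.ne_zero, cast_pow_rpow, mul_comm (a + 1), pow_mul, ← mul_pow, pow_succ,
        mul_comm]
      have h1 := ratio_le hC hCz hσ hp
      have h2 := (pow_OmegaGt_prime_le hC hCz hp).2
      gcongr)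
    N
  refine H.trans (Real.exp_le_exp.2 ?_)
  rw [← Finset.mul_sum]
  have := prime_sum_bound hσ (N + 1)
  gcongr

lemma outer_bound {z C σ : ℝ} (hC : 1 ≤ C) (hCz : 2 * C ≤ z) (hσ : 0 < σ) (N : ℕ) :
    ∑ n ∈ Finset.Icc 1 N, C ^ OmegaGt z n.totient * (n : ℝ) ^ (-(1 + σ)) ≤
      Real.exp (2 * Real.exp (2 * (C * Real.log (1 + 1 / σ)))) := by
  have hC0 : 0 < C := by linarith
  have H := euler_bound_s16 (fun n => C ^ OmegaGt z n.totient * (n : ℝ) ^ (-(1 + σ)))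
    (fun p => C ^ OmegaGt z (p - 1) * (p : ℝ) ^ (-(1 + σ))) (fun n => by positivity)
    (by simp [OmegaGt_one])
    (by
      intro m n hmn
      rcases eq_or_ne m 0 with rfl | hm
      · simp [Real.zero_rpow (show -(1 + σ) ≠ 0 by linarith)]
        try simp [Real.zero_rpow (show -σ + -1 ≠ 0 by linarith)]
      rcases eq_or_ne n 0 with rfl | hn
      · simp [Real.zero_rpow (show -(1 + σ) ≠ 0 by linarith)]
        try simp [Real.zero_rpow (show -σ + -1 ≠ 0 by linarith)]
      rw [Nat.totient_mul hmn, OmegaGt_mul z (Nat.totient_pos.2 (by omega)).ne'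
        (Nat.totient_pos.2 (by omega)).ne', pow_add]
      push_cast
      rw [Real.mul_rpow (by positivity) (by positivity)]; ring)
    (by
      intro p hp a
      have hp1 : p - 1 ≠ 0 := by have := hp.two_le; omega
      rw [Nat.totient_prime_pow_succ hp, OmegaGt_mul z (pow_ne_zero _ hp.ne_zero) hp1,
        OmegaGt_pow z hp.ne_zero, cast_pow_rpow, pow_add, mul_comm a, pow_mul, pow_succ]
      have h1 := pow_le_pow_left₀ (by positivity) (ratio_le hC hCz hσ hp) a
      rw [mul_pow] at h1
      calc _ = C ^ OmegaGt z (p - 1) * (p : ℝ) ^ (-(1 + σ)) *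
            ((C ^ OmegaGt z p) ^ a * ((p : ℝ) ^ (-(1 + σ))) ^ a) := by ring
        _ ≤ _ := mul_le_mul_of_nonneg_left h1 (by positivity))
    N
  refine H.trans (Real.exp_le_exp.2 ?_)
  refine mul_le_mul_of_nonneg_left (le_trans ?_ (inner_bound hC hCz hσ N)) (by norm_num)
  have hinj : Set.InjOn (fun p : ℕ => p - 1) ((N + 1).primesBelow : Set ℕ) := by
    intro p hp q hq h
    have := (Nat.prime_of_mem_primesBelow hp).two_le
    have := (Nat.prime_of_mem_primesBelow hq).two_le
    simp only at h
    omega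
  calc _ ≤ ∑ p ∈ (N + 1).primesBelow,
        C ^ OmegaGt z (p - 1) * ((p - 1 : ℕ) : ℝ) ^ (-(1 + σ)) := by
        refine Finset.sum_le_sum fun p hp => ?_
        have hp2 := (Nat.prime_of_mem_primesBelow hp).two_le
        refine mul_le_mul_of_nonneg_left ?_ (by positivity)
        refine Real.rpow_le_rpow_of_nonpos ?_ ?_ (by linarith)
        · exact_mod_cast (by omega : 0 < p - 1)
        · exact_mod_cast (by omega : p - 1 ≤ p)
    _ = ∑ n ∈ ((N + 1).primesBelow).image (fun p => p - 1),
        C ^ OmegaGt z n * (n : ℝ) ^ (-(1 + σ)) := by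
        rw [Finset.sum_image hinj]
    _ ≤ _ := by
        refine Finset.sum_le_sum_of_subset_of_nonneg ?_ (fun i _ _ => by positivity)
        intro n hn
        rw [Finset.mem_image] at hn
        obtain ⟨p, hp, rfl⟩ := hn
        have := (Nat.prime_of_mem_primesBelow hp).two_le
        have := Nat.lt_of_mem_primesBelow hp
        rw [Finset.mem_Icc]; omega

open Classical in
lemma count_bound_s16 {z C σ K x : ℝ} (hC : 1 ≤ C) (hCz : 2 * C ≤ z) (hσ : 0 < σ) (hx : 0 < x) :
    (((Finset.Icc 1 ⌊x⌋₊).filter (fun m => K ≤ (OmegaGt z (Nat.totient m) : ℝ))).card : ℝ) ≤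
      C ^ (-K) * x ^ (1 + σ) * Real.exp (2 * Real.exp (2 * (C * Real.log (1 + 1 / σ)))) := by
  have hC0 : 0 < C := by linarith
  refine le_trans ?_ (mul_le_mul_of_nonneg_left (outer_bound hC hCz hσ ⌊x⌋₊) (by positivity))
  rw [Finset.mul_sum, Finset.card_eq_sum_ones, Nat.cast_sum]
  refine le_trans (Finset.sum_le_sum fun m hm => ?_) (Finset.sum_le_sum_of_subset_of_nonneg
    (Finset.filter_subset _ _) (fun i _ _ => by positivity))
  rw [Finset.mem_filter, Finset.mem_Icc] at hm
  have hm0 : (0 : ℝ) < m := by exact_mod_cast (by omega : 0 < m)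
  have hmx : (m : ℝ) ≤ x := (Nat.le_floor_iff hx.le).1 hm.1.2
  have h1 : 1 ≤ C ^ (-K) * C ^ OmegaGt z m.totient := by
    rw [← Real.rpow_natCast, ← Real.rpow_add hC0]
    exact Real.one_le_rpow hC (by linarith [hm.2])
  have h2 : 1 ≤ x ^ (1 + σ) * (m : ℝ) ^ (-(1 + σ)) := by
    rw [Real.rpow_neg hm0.le, ← div_eq_mul_inv, ← Real.div_rpow hx.le hm0.le]
    exact Real.one_le_rpow (by rwa [le_div_iff₀ hm0, one_mul]) (by linarith)
  calc ((1 : ℕ) : ℝ) ≤ (C ^ (-K) * C ^ OmegaGt z m.totient) *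
        (x ^ (1 + σ) * (m : ℝ) ^ (-(1 + σ))) := by
        push_cast; exact one_le_mul_of_one_le_of_one_le h1 h2
    _ = _ := by ring

open Filter in
lemma eventually_analytic (k : ℕ) (α δ c : ℝ) (hδ : 0 < δ) (hδ1 : δ < 1) (hc : 0 < c) :
    ∀ᶠ a : ℝ in atTop, 2 ≤ a ∧ 0 < Real.log a ∧ 2 * a ≤ Real.exp (a ^ ((1 : ℝ) / 2)) ∧
      2 ≤ c * (a * Real.log a ^ (α + 1)) ∧
      2 * Real.exp (2 * (a ^ (1 - δ) * Real.log (1 + a ^ (k + 2)))) * a ^ (k + 2) ≤ Real.exp a := by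
  have hlog := Real.tendsto_log_atTop
  have e1 : ∀ᶠ a : ℝ in atTop, 2 * a ≤ Real.exp (a ^ ((1 : ℝ) / 2)) := by
    have h := (tendsto_exp_div_rpow_atTop 2).comp
      (tendsto_rpow_atTop (show (0 : ℝ) < 1 / 2 by norm_num))
    filter_upwards [h.eventually_ge_atTop 2, eventually_gt_atTop 0] with a ha ha0
    simp only [Function.comp] at ha
    rw [← Real.rpow_mul ha0.le, show (1 : ℝ) / 2 * 2 = 1 by norm_num, Real.rpow_one,
      le_div_iff₀ ha0] at ha
    exact ha
  have e2 : ∀ᶠ a : ℝ in atTop, 2 ≤ c * (a * Real.log a ^ (α + 1)) := by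
    have h := (tendsto_exp_div_rpow_atTop (-(α + 1))).comp hlog
    filter_upwards [h.eventually_ge_atTop (2 / c), eventually_gt_atTop 1] with a ha ha0
    have hl := Real.log_pos ha0
    simp only [Function.comp] at ha
    rw [Real.exp_log (by linarith), Real.rpow_neg hl.le, div_inv_eq_mul, div_le_iff₀ hc] at ha
    linarith
  have e3 : ∀ᶠ a : ℝ in atTop, Real.log a ≤ 1 / (6 * (k + 3)) * a ^ δ := by
    have h := (isLittleO_log_rpow_atTop hδ).bound (show (0 : ℝ) < 1 / (6 * (k + 3)) by positivity)
    filter_upwards [h, eventually_gt_atTop 0] with a ha ha0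
    rw [Real.norm_of_nonneg (Real.rpow_nonneg ha0.le δ)] at ha
    exact (le_abs_self _).trans ha
  filter_upwards [e1, e2, e3, eventually_ge_atTop 2] with a h1 h2 h3 ha
  have hl := Real.log_pos (show 1 < a by linarith)
  have ha0 : 0 < a := by linarith
  refine ⟨ha, hl, h1, h2, ?_⟩
  set b := Real.log a
  have hq : Real.log (1 + a ^ (k + 2)) ≤ (k + 3) * b := by
    have : (k + 3 : ℝ) * b = Real.log (a ^ (k + 3)) := by rw [Real.log_pow]; push_cast; rfl
    rw [this]
    apply Real.log_le_log (by positivity)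
    have : 1 ≤ a ^ (k + 2) := one_le_pow₀ (by linarith)
    rw [pow_succ a (k + 2)]
    nlinarith
  have hp : a ^ (k + 2) = Real.exp ((k + 2) * b) := by
    rw [← Real.exp_log (pow_pos ha0 (k + 2)), Real.log_pow]; push_cast; rfl
  have h21 : (2 : ℝ) ≤ Real.exp 1 := by linarith [Real.add_one_le_exp (1 : ℝ)]
  have hA1 : 1 ≤ a ^ (1 - δ) := Real.one_le_rpow (by linarith) (by linarith)
  have hAA : a ^ (1 - δ) * a ^ δ = a := by
    rw [← Real.rpow_add ha0]; simp
  set A := a ^ (1 - δ)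
  have hk : (0 : ℝ) < k + 3 := by positivity
  have h4 : A * b * (3 * (k + 3)) ≤ a / 2 := by
    calc A * b * (3 * (k + 3)) ≤ A * (1 / (6 * (k + 3)) * a ^ δ) * (3 * (k + 3)) := by gcongr
      _ = (A * a ^ δ) / 2 := by field_simp; ring
      _ = a / 2 := by rw [hAA]
  calc 2 * Real.exp (2 * (A * Real.log (1 + a ^ (k + 2)))) * a ^ (k + 2)
      ≤ Real.exp 1 * Real.exp (2 * (A * ((k + 3) * b))) * Real.exp ((k + 2) * b) := by
        rw [← hp]; gcongr
    _ = Real.exp (1 + 2 * (A * ((k + 3) * b)) + (k + 2) * b) := by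
        rw [Real.exp_add, Real.exp_add]
    _ ≤ Real.exp a := by
        apply Real.exp_le_exp.2
        have : (k + 2) * b ≤ A * b * (k + 3) := by
          have h5 : b * (k + 3) ≤ A * (b * (k + 3)) := le_mul_of_one_le_left (by positivity) hA1
          nlinarith
        nlinarith

open Classical in
theorem count_many_large_prime_factors (k : ℕ) (hk : 1 ≤ k) (α : ℝ) :
    ∀ ε : ℝ, 0 < ε → ∃ x₀ : ℝ, ∀ x : ℝ, x₀ ≤ x →
      (((Finset.Icc 1 ⌊x⌋₊).filter (fun m =>
          Real.log (L (k + 1) α x) ≤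
            (OmegaGt (Real.exp (Real.log (Real.log x) ^ ((1 : ℝ) / 2))) (Nat.totient m) : ℝ))).card : ℝ) ≤
        x / (L (k + 1) (α + 1) x) ^ ((1 : ℝ) - ε) := by
  intro ε hε
  obtain ⟨δ, hδ, hδ1, hδε⟩ : ∃ δ : ℝ, 0 < δ ∧ δ < 1 ∧ δ < ε :=
    ⟨min ε 1 / 2, by positivity, by linarith [min_le_right ε 1],
      by have := min_le_left ε 1; linarith⟩
  have hev := ((Real.tendsto_log_atTop.comp Real.tendsto_log_atTop).eventually
    (eventually_analytic k α δ (ε - δ) hδ hδ1 (by linarith)))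
  obtain ⟨x₀, hx₀⟩ := Filter.eventually_atTop.1 (hev.and (Filter.eventually_gt_atTop (Real.exp 1)))
  refine ⟨x₀, fun x hx => ?_⟩
  obtain ⟨⟨ha2, hb, hz, h1, h2⟩, hxe⟩ := hx₀ x hx
  simp only [Function.comp] at ha2 hb hz h1 h2
  have hx0 : 0 < x := lt_trans (Real.exp_pos 1) hxe
  have hl1 : 1 < Real.log x := (Real.lt_log_iff_exp_lt hx0).2 hxe
  have hla : Real.exp (Real.log (Real.log x)) = Real.log x := Real.exp_log (by linarith)
  unfold L
  rw [Real.log_exp]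
  rw [hla] at h2
  have hxl : Real.exp (Real.log x) = x := Real.exp_log hx0
  generalize hl : Real.log x = l at *
  generalize ha : Real.log l = a at *
  have hC1 : 1 ≤ a ^ (1 - δ) := Real.one_le_rpow (by linarith) (by linarith)
  have hCa : a ^ (1 - δ) ≤ a := by
    conv_rhs => rw [← Real.rpow_one a]
    exact Real.rpow_le_rpow_of_exponent_le (by linarith) (by linarith)
  have ha0 : 0 < a := by linarith
  refine (count_bound_s16 (z := Real.exp (a ^ ((1 : ℝ) / 2))) (C := a ^ (1 - δ)) (σ := 1 / a ^ (k + 2))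
    hC1 (by linarith) (by positivity) hx0).trans ?_
  rw [one_div_one_div]
  generalize hbb : Real.log a = b at *
  have e1 : (a ^ (1 - δ)) ^ (-(l * b ^ α / a ^ (k + 1))) =
      Real.exp (-((1 - δ) * (l * b ^ (α + 1) / a ^ (k + 1)))) := by
    rw [← Real.rpow_mul ha0.le, Real.rpow_def_of_pos ha0, hbb, Real.rpow_add_one hb.ne']
    congr 1; ring
  have e2 : x ^ (1 + 1 / a ^ (k + 2)) = Real.exp (l + l / a ^ (k + 2)) := by
    rw [Real.rpow_def_of_pos hx0, hl]; congr 1; ring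
  rw [e1, e2, ← Real.exp_mul, ← Real.exp_add, ← Real.exp_add]
  conv_rhs => rw [← hxl, ← Real.exp_sub]
  apply Real.exp_le_exp.2
  have hl0 : 0 < l := by linarith
  have h3 : 2 * Real.exp (2 * (a ^ (1 - δ) * Real.log (1 + a ^ (k + 2)))) ≤ l / a ^ (k + 2) := by
    rwa [le_div_iff₀ (by positivity)]
  have h4 : 2 * (l / a ^ (k + 2)) ≤ (ε - δ) * (l * b ^ (α + 1) / a ^ (k + 1)) := by
    calc 2 * (l / a ^ (k + 2)) ≤ ((ε - δ) * (a * b ^ (α + 1))) * (l / a ^ (k + 2)) := by gcongr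
      _ = _ := by rw [pow_succ a (k + 1)]; field_simp
  nlinarith
end
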